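/- τ_pp is the unique Polish inverse semigroup topology τ on I(ℕ) such that the set of idempotents {1_A : A ⊆ ℕ} is τ-compact and, for every A ⊆ ℕ, the map r_A : I(ℕ) → R_A, r_A(f) = f ∘ 1_A, is open onto R_A with its subspace topology. That is: τ_pp has these properties, and any Polish topology τ on I(ℕ) for which composition and inversion are continuous, the idempotents are τ-compact, and each r_A is τ-open onto R_A, equals τ_pp. -/

import Mathlib

open TopologicalSpace Filter

/-- A partial bijection on `X`, represented by its graph. -/
structure PartialBij (X : Type*) where
  graph : Set (X × X)
  functional : ∀ ⦃x y y'⦄, (x, y) ∈ graph → (x, y') ∈ graph → y = y'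
  coinjective : ∀ ⦃x x' y⦄, (x, y) ∈ graph → (x', y) ∈ graph → x = x'

namespace PartialBij

variable {X : Type*}

/-- Composition `f ∘ g` of partial bijections. -/
def comp (f g : PartialBij X) : PartialBij X where
  graph := {p | ∃ y, (p.1, y) ∈ g.graph ∧ (y, p.2) ∈ f.graph}
  functional := by
    rintro x y y' ⟨z, hz1, hz2⟩ ⟨z', hz1', hz2'⟩
    obtain rfl := g.functional hz1 hz1'
    exact f.functional hz2 hz2'
  coinjective := by
    rintro x x' y ⟨z, hz1, hz2⟩ ⟨z', hz1', hz2'⟩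
    obtain rfl := f.coinjective hz2 hz2'
    exact g.coinjective hz1 hz1'

/-- Inversion `f ↦ f⁻¹` of partial bijections. -/
def inv (f : PartialBij X) : PartialBij X where
  graph := {p | (p.2, p.1) ∈ f.graph}
  functional := fun _ _ _ h h' => f.coinjective h h'
  coinjective := fun _ _ _ h h' => f.functional h h'

/-- Domain of a partial bijection. -/
def dom (f : PartialBij X) : Set X := {x | ∃ y, (x, y) ∈ f.graph}

/-- Image of a partial bijection. -/
def im (f : PartialBij X) : Set X := {y | ∃ x, (x, y) ∈ f.graph}

/-- `v x y = {f : x ∈ dom f and f(x) = y}`. -/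
def v (x y : X) : Set (PartialBij X) := {f | (x, y) ∈ f.graph}

/-- `w₁ x = {f : x ∉ dom f}`. -/
def w1 (x : X) : Set (PartialBij X) := {f | x ∉ f.dom}

/-- `w₂ y = {f : y ∉ im f}`. -/
def w2 (y : X) : Set (PartialBij X) := {f | y ∉ f.im}

/-- The topology generated by the sets `v x y`. -/
def tau0 (X : Type*) : TopologicalSpace (PartialBij X) :=
  generateFrom {s | ∃ x y, s = v x y}

/-- The topology generated by the sets `v x y` and `w₁ x`. -/
def tau1 (X : Type*) : TopologicalSpace (PartialBij X) :=
  generateFrom ({s | ∃ x y, s = v x y} ∪ {s | ∃ x, s = w1 x})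

/-- The topology generated by the sets `v x y` and `w₂ y`. -/
def tau2 (X : Type*) : TopologicalSpace (PartialBij X) :=
  generateFrom ({s | ∃ x y, s = v x y} ∪ {s | ∃ y, s = w2 y})

/-- The partial product topology, generated by the sets `v x y`, `w₁ x` and `w₂ y`. -/
def taupp (X : Type*) : TopologicalSpace (PartialBij X) :=
  generateFrom ({s | ∃ x y, s = v x y} ∪ {s | ∃ x, s = w1 x} ∪ {s | ∃ y, s = w2 y})

/-- The partial identity `1_A` on `A ⊆ X`. -/
def partialId (A : Set X) : PartialBij X where
  graph := {p | p.1 ∈ A ∧ p.1 = p.2}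
  functional := by rintro x y y' ⟨_, h⟩ ⟨_, h'⟩; exact h.symm.trans h'
  coinjective := by rintro x x' y ⟨_, h⟩ ⟨_, h'⟩; exact h.trans h'.symm

/-- The product (Cantor) topology on the power set `2^X`. -/
def cantorTop (X : Type*) : TopologicalSpace (Set X) :=
  generateFrom ({s | ∃ x, s = {A : Set X | x ∈ A}} ∪ {s | ∃ x, s = {A : Set X | x ∉ A}})

open Classical in
/-- Evaluation of a partial bijection at a point of its domain (with junk value `x`
  outside of the domain). -/
noncomputable def evalAt (x : X) (f : PartialBij X) : X :=
  if h : x ∈ f.dom then h.choose else x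

end PartialBij

namespace PartialBij

/-- `τ` is a Polish inverse semigroup topology on `I(ℕ)` such that the set of
idempotents is `τ`-compact and, for every `A ⊆ ℕ`, the right translation
`r_A : f ↦ f ∘ 1_A` is open onto `R_A = {f ∘ 1_A : f ∈ I(ℕ)}` with its subspace
topology. -/
def GoodTop (τ : TopologicalSpace (PartialBij ℕ)) : Prop :=
  @PolishSpace (PartialBij ℕ) τ ∧
  @Continuous (PartialBij ℕ × PartialBij ℕ) (PartialBij ℕ)
    (@instTopologicalSpaceProd _ _ τ τ) τ (fun p => p.1.comp p.2) ∧
  @Continuous (PartialBij ℕ) (PartialBij ℕ) τ τ inv ∧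
  @IsCompact (PartialBij ℕ) τ (Set.range (partialId : Set ℕ → PartialBij ℕ)) ∧
  ∀ A : Set ℕ,
    @IsOpenMap (PartialBij ℕ) (Set.range fun g : PartialBij ℕ => g.comp (partialId A))
      τ (@instTopologicalSpaceSubtype _ _ τ)
      (fun g => ⟨g.comp (partialId A), g, rfl⟩)

end PartialBij


open Topology in
theorem polishGroup_open {G H : Type*} [Group G] [TopologicalSpace G] [IsTopologicalGroup G]
    [PolishSpace G] [Group H] [TopologicalSpace H] [IsTopologicalGroup H] [PolishSpace H]
    (φ : G →* H) (hφ : Continuous φ) (hb : Function.Bijective φ) :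
    𝓝 (1 : H) ≤ map φ (𝓝 (1 : G)) := by
  intro U hU
  rw [mem_map] at hU
  -- find V open with V / V ⊆ U
  obtain ⟨V, hV, hVo, hVU⟩ : ∃ V ∈ 𝓝 (1 : G), IsOpen V ∧ ∀ v ∈ V, ∀ w ∈ V, v * w⁻¹ ∈ φ ⁻¹' U := by
    obtain ⟨V, hVo, hV1, hVU⟩ := exists_open_nhds_one_mul_subset hU
    refine ⟨V ∩ V⁻¹, ?_, hVo.inter hVo.inv, ?_⟩
    · exact inter_mem (hVo.mem_nhds hV1) ((hVo.inv).mem_nhds (by simpa using hV1))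
    · intro v hv w hw
      exact hVU (Set.mul_mem_mul hv.1 (by simpa using hw.2))
  have h1V : (1 : G) ∈ V := mem_of_mem_nhds hV
  -- image is Borel
  have hmeas : BaireMeasurableSet (φ '' V) := by
    borelize G H
    exact (hVo.measurableSet.image_of_continuousOn_injOn hφ.continuousOn
      hb.injective.injOn).baireMeasurableSet
  -- not meagre
  have hnm : ¬ IsMeagre (φ '' V) := by
    intro hm
    obtain ⟨s, hs, hsd⟩ := TopologicalSpace.exists_countable_dense G
    have hcov : (⋃ g ∈ s, (fun h : H => (φ g)⁻¹ * h) ⁻¹' (φ '' V)) = Set.univ := by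
      rw [Set.eq_univ_iff_forall]
      intro h
      obtain ⟨x, rfl⟩ := hb.surjective h
      have : IsOpen ((fun g : G => g⁻¹ * x) ⁻¹' V) := hVo.preimage (by fun_prop)
      obtain ⟨g, hg, hgs⟩ := hsd.inter_open_nonempty _ this ⟨x, by simpa using h1V⟩
      simp only [Set.mem_iUnion]
      exact ⟨g, hgs, g⁻¹ * x, hg, by simp⟩
    have hmm : IsMeagre (⋃ g ∈ s, (fun h : H => (φ g)⁻¹ * h) ⁻¹' (φ '' V)) := by
      have := hs.to_subtype
      rw [Set.biUnion_eq_iUnion]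
      refine isMeagre_iUnion fun g => ?_
      exact hm.preimage_of_isOpenMap (continuous_const_mul _) (isOpenMap_mul_left _)
    rw [hcov] at hmm
    exact not_isMeagre_of_isOpen isOpen_univ ⟨1, trivial⟩ hmm
  obtain ⟨O, hO, hVO⟩ := hmeas.residualEq_isOpen
  have hne : O.Nonempty := by
    by_contra hne
    rw [Set.not_nonempty_iff_eq_empty] at hne
    subst hne
    apply hnm
    filter_upwards [eventuallyEq_set.1 hVO] with x hx hx'
    exact (hx.1 hx')
  obtain ⟨o, ho⟩ := hne
  have : ∀ᶠ h in 𝓝 (1 : H), h⁻¹ * o ∈ O := by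
    apply (show Continuous fun h : H => h⁻¹ * o by fun_prop).continuousAt.eventually_mem
    simpa using hO.mem_nhds ho
  filter_upwards [this] with h hh
  -- O ∩ hO nonempty open
  have hO2 : IsOpen (O ∩ (fun x => h⁻¹ * x) ⁻¹' O) := hO.inter (hO.preimage (by fun_prop))
  have ht := tendsto_residual_of_isOpenMap (continuous_const_mul (h⁻¹)) (isOpenMap_mul_left (h⁻¹))
  have hVO' := eventuallyEq_set.1 hVO
  have hE := hVO'.and (ht.eventually hVO')
  by_contra hcon
  refine not_isMeagre_of_isOpen hO2 ⟨o, ho, hh⟩ ?_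
  filter_upwards [hE] with x hx hx'
  obtain ⟨v, hv, hvx⟩ := hx.1.2 hx'.1
  obtain ⟨w, hw, hwx⟩ := hx.2.2 hx'.2
  have := hVU v hv w hw
  simp only [Set.mem_preimage, map_mul, map_inv, hvx, hwx] at this
  apply hcon
  simpa using this

theorem polishGroup_unique {G : Type*} [Group G] (t1 t2 : TopologicalSpace G)
    (g1 : @IsTopologicalGroup G t1 _) (g2 : @IsTopologicalGroup G t2 _)
    (p1 : @PolishSpace G t1) (p2 : @PolishSpace G t2) (h : t1 ≤ t2) : t1 = t2 := by
  refine IsTopologicalGroup.ext g1 g2 (le_antisymm (nhds_mono h) ?_)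
  have := @polishGroup_open G G _ t1 g1 p1 _ t2 g2 p2 (MonoidHom.id G)
    (continuous_id_iff_le.2 h) Function.bijective_id
  simpa using this
namespace PartialBij

section Aux

open Topology

theorem gext {X : Type*} {f g : PartialBij X} (h : ∀ x y, (x, y) ∈ f.graph ↔ (x, y) ∈ g.graph) :
    f = g := by
  cases f; cases g
  congr
  ext ⟨x, y⟩
  exact h x y

theorem mem_comp {X : Type*} {f g : PartialBij X} {x y : X} :
    (x, y) ∈ (f.comp g).graph ↔ ∃ z, (x, z) ∈ g.graph ∧ (z, y) ∈ f.graph := Iff.rfl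

theorem mem_inv {X : Type*} {f : PartialBij X} {x y : X} :
    (x, y) ∈ f.inv.graph ↔ (y, x) ∈ f.graph := Iff.rfl

theorem mem_pid {X : Type*} {A : Set X} {x y : X} :
    (x, y) ∈ (partialId A).graph ↔ x ∈ A ∧ x = y := Iff.rfl

theorem mem_dom {X : Type*} {f : PartialBij X} {x : X} :
    x ∈ f.dom ↔ ∃ y, (x, y) ∈ f.graph := Iff.rfl

theorem mem_im {X : Type*} {f : PartialBij X} {x : X} :
    x ∈ f.im ↔ ∃ y, (y, x) ∈ f.graph := Iff.rfl

instance instMonoidPB : Monoid (PartialBij ℕ) where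
  mul := comp
  one := partialId Set.univ
  mul_assoc f g h := by
    change (f.comp g).comp h = f.comp (g.comp h)
    refine gext fun x y => ?_
    simp only [mem_comp]
    grind
  one_mul f := by
    change (partialId Set.univ).comp f = f
    refine gext fun x y => ?_
    simp [mem_comp, mem_pid]
  mul_one f := by
    change f.comp (partialId Set.univ) = f
    refine gext fun x y => ?_
    simp [mem_comp, mem_pid]

theorem mul_def' (f g : PartialBij ℕ) : f * g = f.comp g := rfl
theorem one_def' : (1 : PartialBij ℕ) = partialId Set.univ := rfl

/-- relation underlying the unitary dilation of a partial bijection -/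
def dilRel (f : PartialBij ℕ) : ℕ ⊕ ℕ → ℕ ⊕ ℕ → Prop
  | .inl a, .inl b => (a, b) ∈ f.graph
  | .inl a, .inr b => a = b ∧ a ∉ f.dom
  | .inr a, .inl b => a = b ∧ a ∉ f.im
  | .inr a, .inr b => (b, a) ∈ f.graph

theorem dilRel_inv (f : PartialBij ℕ) (s t : ℕ ⊕ ℕ) : dilRel f.inv s t ↔ dilRel f t s := by
  rcases s with a | a <;> rcases t with b | b <;> simp only [dilRel, mem_inv, mem_dom, mem_im] <;>
    grind

theorem dilRel_fun (f : PartialBij ℕ) {s t t' : ℕ ⊕ ℕ} (h : dilRel f s t) (h' : dilRel f s t') :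
    t = t' := by
  have := f.functional
  have := f.coinjective
  rcases s with a | a <;> rcases t with b | b <;> rcases t' with c | c <;>
    simp only [dilRel, mem_dom, mem_im] at h h' <;> grind

theorem dilRel_total (f : PartialBij ℕ) (s : ℕ ⊕ ℕ) : ∃ t, dilRel f s t := by
  rcases s with a | a
  · by_cases h : a ∈ f.dom
    · obtain ⟨b, hb⟩ := h
      exact ⟨.inl b, hb⟩
    · exact ⟨.inr a, rfl, h⟩
  · by_cases h : a ∈ f.im
    · obtain ⟨b, hb⟩ := h
      exact ⟨.inr b, hb⟩
    · exact ⟨.inl a, rfl, h⟩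

/-- the dilation -/
def dil (f : PartialBij ℕ) : PartialBij ℕ where
  graph := {p | dilRel f (Equiv.natSumNatEquivNat.symm p.1) (Equiv.natSumNatEquivNat.symm p.2)}
  functional x y y' h h' := Equiv.natSumNatEquivNat.symm.injective (dilRel_fun f h h')
  coinjective x x' y h h' := Equiv.natSumNatEquivNat.symm.injective
    (dilRel_fun f.inv ((dilRel_inv _ _ _).2 h) ((dilRel_inv _ _ _).2 h'))

theorem mem_dil (f : PartialBij ℕ) (x y : ℕ) : (x, y) ∈ (dil f).graph ↔
  dilRel f (Equiv.natSumNatEquivNat.symm x) (Equiv.natSumNatEquivNat.symm y) := Iff.rfl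

theorem inv_inv' (f : PartialBij ℕ) : f.inv.inv = f := rfl

theorem dil_inv (f : PartialBij ℕ) : dil f.inv = (dil f).inv :=
  gext fun _ _ => dilRel_inv _ _ _

theorem dil_dom (f : PartialBij ℕ) (x : ℕ) : x ∈ (dil f).dom := by
  obtain ⟨t, ht⟩ := dilRel_total f (Equiv.natSumNatEquivNat.symm x)
  exact ⟨Equiv.natSumNatEquivNat t, by
    rw [mem_dil, Equiv.symm_apply_apply]
    exact ht⟩

theorem dil_im (f : PartialBij ℕ) (x : ℕ) : x ∈ (dil f).im := by
  have := dil_dom f.inv x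
  rw [dil_inv] at this
  exact this

theorem dil_mul (f : PartialBij ℕ) : dil f.inv * dil f = 1 := by
  rw [dil_inv, mul_def', one_def']
  refine gext fun x y => ?_
  simp only [mem_comp, mem_inv, mem_pid]
  constructor
  · rintro ⟨z, h, h'⟩
    exact ⟨trivial, (dil f).coinjective h h'⟩
  · rintro ⟨-, rfl⟩
    obtain ⟨z, hz⟩ := dil_dom f x
    exact ⟨z, hz, hz⟩

/-- dilation as a unit -/
def dilU (f : PartialBij ℕ) : (PartialBij ℕ)ˣ where
  val := dil f
  inv := dil f.inv
  val_inv := dil_mul f.inv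
  inv_val := dil_mul f

/-- the embedding on the left copy -/
def leftCopy : PartialBij ℕ where
  graph := {p | p.2 = Equiv.natSumNatEquivNat (.inl p.1)}
  functional x y y' h h' := by simp_all
  coinjective x x' y h h' := by
    have : Equiv.natSumNatEquivNat (.inl x) = Equiv.natSumNatEquivNat (.inl x') :=
      h.symm.trans h'
    exact Sum.inl_injective (Equiv.natSumNatEquivNat.injective this)

theorem mem_left (x y : ℕ) : (x, y) ∈ leftCopy.graph ↔ y = Equiv.natSumNatEquivNat (.inl x) :=
  Iff.rfl

theorem compress (f : PartialBij ℕ) : leftCopy.inv * (dil f * leftCopy) = f := by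
  refine gext fun x y => ?_
  simp only [mul_def', mem_comp, mem_inv, mem_left]
  constructor
  · rintro ⟨z, ⟨w, rfl, h⟩, rfl⟩
    rw [mem_dil, Equiv.symm_apply_apply, Equiv.symm_apply_apply] at h
    exact h
  · intro h
    refine ⟨_, ⟨_, rfl, ?_⟩, rfl⟩
    rw [mem_dil, Equiv.symm_apply_apply, Equiv.symm_apply_apply]
    exact h

/-! ### basic facts on taupp -/

theorem isOpen_v (x y : ℕ) : IsOpen[taupp ℕ] (v x y) :=
  isOpen_generateFrom_of_mem (.inl (.inl ⟨x, y, rfl⟩))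
theorem isOpen_w1 (x : ℕ) : IsOpen[taupp ℕ] (w1 x) :=
  isOpen_generateFrom_of_mem (.inl (.inr ⟨x, rfl⟩))
theorem isOpen_w2 (x : ℕ) : IsOpen[taupp ℕ] (w2 x) :=
  isOpen_generateFrom_of_mem (.inr ⟨x, rfl⟩)

theorem continuous_taupp {Y : Type*} [t : TopologicalSpace Y] {g : Y → PartialBij ℕ}
    (hv : ∀ x y, IsOpen (g ⁻¹' (v x y))) (h1 : ∀ x, IsOpen (g ⁻¹' (w1 x)))
    (h2 : ∀ x, IsOpen (g ⁻¹' (w2 x))) : @Continuous _ _ t (taupp ℕ) g := by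
  refine continuous_generateFrom_iff.2 ?_
  rintro s ((⟨x, y, rfl⟩ | ⟨x, rfl⟩) | ⟨x, rfl⟩)
  exacts [hv _ _, h1 _, h2 _]

theorem continuous_inv_taupp : @Continuous _ _ (taupp ℕ) (taupp ℕ) (inv : PartialBij ℕ → _) :=
  @continuous_taupp _ (taupp ℕ) _ (fun x y => isOpen_v y x) (fun x => isOpen_w2 x)
    (fun x => isOpen_w1 x)

theorem continuous_comp_taupp : @Continuous (PartialBij ℕ × PartialBij ℕ) (PartialBij ℕ)
    (@instTopologicalSpaceProd _ _ (taupp ℕ) (taupp ℕ)) (taupp ℕ) (fun p => p.1.comp p.2) := by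
  let := taupp ℕ
  refine continuous_taupp (fun x y => ?_) (fun x => ?_) (fun y => ?_)
  · have : (fun p : PartialBij ℕ × PartialBij ℕ => p.1.comp p.2) ⁻¹' (v x y) =
        ⋃ z, (v z y) ×ˢ (v x z) := by
      ext ⟨f, g⟩
      simp only [Set.mem_preimage, Set.mem_iUnion, Set.mem_prod, v, Set.mem_ofPred_eq, mem_comp]
      grind
    rw [this]
    exact isOpen_iUnion fun z => (isOpen_v _ _).prod (isOpen_v _ _)
  · have : (fun p : PartialBij ℕ × PartialBij ℕ => p.1.comp p.2) ⁻¹' (w1 x) =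
        (Set.univ ×ˢ w1 x) ∪ ⋃ z, (w1 z) ×ˢ (v x z) := by
      ext ⟨f, g⟩
      have := g.functional
      simp only [Set.mem_preimage, Set.mem_iUnion, Set.mem_prod, v, w1, Set.mem_ofPred_eq, mem_comp,
        mem_dom, Set.mem_union, Set.mem_univ]
      grind
    rw [this]
    exact (isOpen_univ.prod (isOpen_w1 _)).union
      (isOpen_iUnion fun z => (isOpen_w1 _).prod (isOpen_v _ _))
  · have : (fun p : PartialBij ℕ × PartialBij ℕ => p.1.comp p.2) ⁻¹' (w2 y) =
        (w2 y ×ˢ Set.univ) ∪ ⋃ z, (v z y) ×ˢ (w2 z) := by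
      ext ⟨f, g⟩
      have := f.coinjective
      simp only [Set.mem_preimage, Set.mem_iUnion, Set.mem_prod, v, w2, Set.mem_ofPred_eq, mem_comp,
        mem_im, Set.mem_union, Set.mem_univ]
      grind
    rw [this]
    exact ((isOpen_w2 _).prod isOpen_univ).union
      (isOpen_iUnion fun z => (isOpen_v _ _).prod (isOpen_w2 _))

theorem continuous_dil_taupp : @Continuous _ _ (taupp ℕ) (taupp ℕ) dil := by
  let := taupp ℕ
  refine continuous_taupp (fun x y => ?_) (fun x => ?_) (fun y => ?_)
  · obtain ⟨s, rfl⟩ := Equiv.natSumNatEquivNat.surjective x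
    obtain ⟨t, rfl⟩ := Equiv.natSumNatEquivNat.surjective y
    have : dil ⁻¹' (v (Equiv.natSumNatEquivNat s) (Equiv.natSumNatEquivNat t)) =
        {f | dilRel f s t} := by
      ext f
      simp only [v, Set.mem_preimage, Set.mem_ofPred_eq, mem_dil, Equiv.symm_apply_apply]
    rw [this]
    rcases s with a | a <;> rcases t with b | b <;> simp only [dilRel]
    · exact isOpen_v _ _
    · exact isOpen_const.and (isOpen_w1 _)
    · exact isOpen_const.and (isOpen_w2 _)
    · exact isOpen_v _ _
  · convert isOpen_empty
    ext f
    simp [w1, dil_dom]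
  · convert isOpen_empty
    ext f
    simp [w2, dil_im]

/-! ### Polishness -/

open Classical in
/-- code of a partial function as a function: `0` off the domain, `y + 1` at points sent to `y`. -/
noncomputable def code (f : PartialBij ℕ) (x : ℕ) : ℕ := if h : x ∈ f.dom then h.choose + 1 else 0

theorem code_succ (f : PartialBij ℕ) (x y : ℕ) : code f x = y + 1 ↔ (x, y) ∈ f.graph := by
  unfold code
  split_ifs with h
  · rw [Nat.add_right_cancel_iff]
    constructor
    · rintro rfl; exact h.choose_spec
    · intro h'; exact f.functional h.choose_spec h'
  · simp only [mem_dom, not_exists] at h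
    simp [h]

theorem code_zero (f : PartialBij ℕ) (x : ℕ) : code f x = 0 ↔ x ∉ f.dom := by
  unfold code
  split_ifs with h <;> simp [h]

/-- the embedding used for Polishness -/
noncomputable def emb (f : PartialBij ℕ) : (ℕ → ℕ) × (ℕ → ℕ) := (code f, code f.inv)

theorem continuous_code : @Continuous _ _ (taupp ℕ) _ code := by
  let := taupp ℕ
  refine continuous_pi fun x => continuous_discrete_rng.2 fun n => ?_
  rcases n with _ | n
  · convert isOpen_w1 x using 1
    ext f; simp [code_zero, w1]
  · convert isOpen_v x n using 1
    ext f; simp [code_succ, v]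

theorem range_emb : Set.range emb = {p | ∀ x y, p.1 x = y + 1 ↔ p.2 y = x + 1} := by
  ext ⟨a, b⟩
  constructor
  · rintro ⟨f, hf⟩ x y
    rw [← hf]
    simp only [emb, code_succ, mem_inv]
  · intro h
    simp only [Set.mem_ofPred_eq] at h
    let f : PartialBij ℕ := ⟨{p | a p.1 = p.2 + 1}, by
      intro x y y' h1 h2
      simp only [Set.mem_ofPred_eq] at h1 h2; omega, by
      intro x x' y h1 h2
      simp only [Set.mem_ofPred_eq, h] at h1 h2; omega⟩
    have hf : ∀ x y, (x, y) ∈ f.graph ↔ a x = y + 1 := fun _ _ => Iff.rfl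
    have key : ∀ (g : PartialBij ℕ) (c : ℕ → ℕ), (∀ x y, (x, y) ∈ g.graph ↔ c x = y + 1) →
        code g = c := by
      intro g c hg
      ext x
      rcases hc : c x with _ | n
      · rw [code_zero]
        rintro ⟨y, hy⟩
        rw [hg] at hy; omega
      · rw [code_succ, hg, hc]
    refine ⟨f, Prod.ext (key _ _ hf) (key _ _ fun x y => ?_)⟩
    rw [mem_inv, hf, h]

theorem isClosedEmbedding_emb : @Topology.IsClosedEmbedding _ _ (taupp ℕ) _ emb := by
  let := taupp ℕ
  have hc : Continuous emb := continuous_code.prodMk (continuous_code.comp continuous_inv_taupp)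
  refine ⟨⟨⟨le_antisymm hc.le_induced ?_⟩, ?_⟩, ?_⟩
  · rw [← continuous_id_iff_le]
    let : TopologicalSpace (PartialBij ℕ) := TopologicalSpace.induced emb inferInstance
    have he : Continuous emb := continuous_induced_dom
    have e1 : ∀ x, Continuous fun f => code f x := fun x =>
      (continuous_apply x).comp (continuous_fst.comp he)
    have e2 : ∀ x, Continuous fun f : PartialBij ℕ => code f.inv x := fun x =>
      (continuous_apply x).comp (continuous_snd.comp he)
    refine continuous_taupp (fun x y => ?_) (fun x => ?_) (fun x => ?_)
    · convert (isOpen_discrete {y + 1}).preimage (e1 x) using 1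
      ext f; simp [code_succ, v]
    · convert (isOpen_discrete {0}).preimage (e1 x) using 1
      ext f; simp [code_zero, w1]
    · convert (isOpen_discrete {0}).preimage (e2 x) using 1
      ext f
      simp only [Set.mem_preimage, Set.mem_singleton_iff, code_zero]
      rfl
  · intro f g h
    refine gext fun x y => ?_
    rw [← code_succ, ← code_succ]
    simp only [emb, Prod.mk.injEq] at h
    rw [h.1]
  · rw [range_emb]
    simp only [Set.ofPred_forall]
    refine isClosed_iInter fun x => isClosed_iInter fun y => ?_
    have : Continuous fun p : (ℕ → ℕ) × (ℕ → ℕ) => (p.1 x, p.2 y) := by fun_prop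
    exact (isClosed_discrete {q : ℕ × ℕ | q.1 = y + 1 ↔ q.2 = x + 1}).preimage this

theorem polish_taupp : @PolishSpace _ (taupp ℕ) := by
  let := taupp ℕ
  exact isClosedEmbedding_emb.polishSpace

theorem compact_taupp :
    @IsCompact _ (taupp ℕ) (Set.range (partialId : Set ℕ → PartialBij ℕ)) := by
  let := taupp ℕ
  have hc : Continuous fun a : ℕ → Bool => (partialId {n | a n = true} : PartialBij ℕ) := by
    have hb : ∀ x (b : Bool), IsOpen {a : ℕ → Bool | a x = b} := fun x b =>
      (isOpen_discrete ({b} : Set Bool)).preimage (show Continuous fun a : ℕ → Bool => a x by fun_prop)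
    refine continuous_taupp (fun x y => ?_) (fun x => ?_) (fun x => ?_)
    · convert (hb x true).and (isOpen_const (p := x = y)) using 1
      ext a; simp [v, mem_pid]
    · convert hb x false using 1
      ext a; simp [w1, mem_dom, mem_pid]
    · convert hb x false using 1
      ext a; simp [w2, mem_im, mem_pid]; grind
  convert isCompact_range hc using 1
  ext f
  constructor
  · rintro ⟨A, rfl⟩
    classical
    exact ⟨fun n => decide (n ∈ A), by simp⟩
  · rintro ⟨a, rfl⟩
    exact ⟨_, rfl⟩


/-- A section of the right translation by `1_A` passing through `g`. -/
def sec (A : Set ℕ) (g h : PartialBij ℕ) : PartialBij ℕ where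
  graph := {p | (p.1 ∈ A ∧ (p.1, p.2) ∈ h.graph) ∨ (p.1 ∉ A ∧ (p.1, p.2) ∈ g.graph ∧ p.2 ∉ h.im)}
  functional := by
    rintro x y y' (⟨h1, h2⟩ | ⟨h1, h2, h3⟩) (⟨k1, k2⟩ | ⟨k1, k2, k3⟩)
    · exact h.functional h2 k2
    · exact absurd h1 k1
    · exact absurd k1 h1
    · exact g.functional h2 k2
  coinjective := by
    rintro x x' y (⟨h1, h2⟩ | ⟨h1, h2, h3⟩) (⟨k1, k2⟩ | ⟨k1, k2, k3⟩)
    · exact h.coinjective h2 k2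
    · exact absurd ⟨_, h2⟩ k3
    · exact absurd ⟨_, k2⟩ h3
    · exact g.coinjective h2 k2

theorem mem_sec {A : Set ℕ} {g h : PartialBij ℕ} {x y : ℕ} : (x, y) ∈ (sec A g h).graph ↔
    (x ∈ A ∧ (x, y) ∈ h.graph) ∨ (x ∉ A ∧ (x, y) ∈ g.graph ∧ y ∉ h.im) := Iff.rfl

theorem isOpen_im (y : ℕ) : IsOpen[taupp ℕ] {h : PartialBij ℕ | y ∈ h.im} := by
  let := taupp ℕ
  have : {h : PartialBij ℕ | y ∈ h.im} = ⋃ z, v z y := by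
    ext h; simp [mem_im, v]
  rw [this]
  exact isOpen_iUnion fun z => isOpen_v _ _

theorem continuous_sec (A : Set ℕ) (g : PartialBij ℕ) :
    @Continuous _ _ (taupp ℕ) (taupp ℕ) (sec A g) := by
  let := taupp ℕ
  refine continuous_taupp (fun x y => ?_) (fun x => ?_) (fun y => ?_)
  · exact IsOpen.union (isOpen_const.and (isOpen_v x y))
      (isOpen_const.and (isOpen_const.and (isOpen_w2 y)))
  · by_cases hx : x ∈ A
    · convert isOpen_w1 x using 1
      ext h
      simp [w1, mem_dom, mem_sec, hx]
    · by_cases hg : x ∈ g.dom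
      · obtain ⟨y, hy⟩ := hg
        convert isOpen_im y using 1
        ext h
        have := g.functional
        simp only [w1, Set.mem_preimage, Set.mem_ofPred_eq, mem_dom, mem_sec]
        grind
      · convert isOpen_univ
        ext h
        simp only [w1, Set.mem_preimage, Set.mem_ofPred_eq, mem_dom, mem_sec, Set.mem_univ] at hg ⊢
        grind
  · have h1 : IsOpen {h : PartialBij ℕ | ¬ ∃ x, x ∈ A ∧ (x, y) ∈ h.graph} := by
      have : {h : PartialBij ℕ | ¬ ∃ x, x ∈ A ∧ (x, y) ∈ h.graph} =
          w2 y ∪ ⋃ x, {h | x ∉ A ∧ h ∈ v x y} := by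
        ext h
        have := h.coinjective
        simp only [w2, v, Set.mem_ofPred_eq, mem_im, Set.mem_union, Set.mem_iUnion]
        grind
      rw [this]
      exact (isOpen_w2 y).union (isOpen_iUnion fun x => isOpen_const.and (isOpen_v _ _))
    have h2 : IsOpen {h : PartialBij ℕ | ¬ ((∃ x, x ∉ A ∧ (x, y) ∈ g.graph) ∧ y ∉ h.im)} := by
      by_cases hy : ∃ x, x ∉ A ∧ (x, y) ∈ g.graph
      · simp only [hy, true_and, not_not]
        exact isOpen_im y
      · simp only [hy, false_and, not_false_eq_true]
        exact isOpen_const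
    convert h1.and h2 using 1
    ext h
    simp only [w2, Set.mem_preimage, Set.mem_ofPred_eq, mem_im, mem_sec]
    grind

theorem openMap_taupp (A : Set ℕ) :
    @IsOpenMap (PartialBij ℕ) (Set.range fun g : PartialBij ℕ => g.comp (partialId A))
      (taupp ℕ) (@instTopologicalSpaceSubtype _ _ (taupp ℕ))
      (fun g => ⟨g.comp (partialId A), g, rfl⟩) := by
  let := taupp ℕ
  refine IsOpenMap.of_sections fun g => ⟨fun h => sec A g h.1, ?_, ?_, ?_⟩
  · exact ((continuous_sec A g).comp continuous_subtype_val).continuousAt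
  · refine gext fun x y => ?_
    have := g.coinjective
    simp only [mem_sec, mem_comp, mem_pid, mem_im]
    grind
  · rintro ⟨_, k, rfl⟩
    refine Subtype.ext (gext fun x y => ?_)
    simp only [mem_sec, mem_comp, mem_pid, mem_im]
    grind

theorem good_taupp : GoodTop (taupp ℕ) :=
  ⟨polish_taupp, continuous_comp_taupp, continuous_inv_taupp, compact_taupp, openMap_taupp⟩

/-! ### uniqueness -/

theorem le_taupp (τ : TopologicalSpace (PartialBij ℕ)) (h1 : T1Space (PartialBij ℕ))
    (hm : ContinuousMul (PartialBij ℕ)) (hi : Continuous (inv : PartialBij ℕ → PartialBij ℕ)) :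
    τ ≤ taupp ℕ := by
  have hw1 : ∀ x : ℕ, IsOpen (w1 x : Set (PartialBij ℕ)) := by
    intro x
    have hc : Continuous fun f : PartialBij ℕ => (f.inv * f) * partialId {x} := by fun_prop
    convert (isOpen_compl_singleton (x := (partialId {x} : PartialBij ℕ))).preimage hc using 1
    ext f
    simp only [w1, Set.mem_ofPred_eq, Set.mem_preimage, Set.mem_compl_iff, Set.mem_singleton_iff]
    refine not_congr ⟨?_, ?_⟩
    · rintro ⟨y, hy⟩
      refine gext fun a b => ?_
      have := f.coinjective
      simp only [mul_def', mem_comp, mem_inv, mem_pid, Set.mem_singleton_iff]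
      grind
    · intro h
      have : (x, x) ∈ (f.inv * f * partialId {x}).graph := by
        rw [h]; exact ⟨rfl, rfl⟩
      obtain ⟨z, ⟨-, hz⟩, w, hw, -⟩ := this
      change x = z at hz
      subst hz
      exact ⟨w, hw⟩
  refine continuous_id_iff_le.1 (continuous_taupp (fun x y => ?_) hw1 fun y => (hw1 y).preimage hi)
  have hc : Continuous fun f : PartialBij ℕ => partialId {y} * (f * partialId {x}) := by fun_prop
  convert (isOpen_compl_singleton (x := (partialId ∅ : PartialBij ℕ))).preimage hc using 1
  ext f
  simp only [v, Set.mem_ofPred_eq, Set.mem_preimage, Set.mem_compl_iff, Set.mem_singleton_iff, id]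
  constructor
  · intro hxy h
    have : (x, y) ∈ (partialId {y} * (f * partialId {x})).graph :=
      ⟨y, ⟨x, ⟨rfl, rfl⟩, hxy⟩, rfl, rfl⟩
    rw [h] at this
    exact this.1
  · intro h
    by_contra hxy
    apply h
    refine gext fun a b => ?_
    simp only [mul_def', mem_comp, mem_pid, Set.mem_singleton_iff, Set.mem_empty_iff_false]
    grind

theorem units_polish {M : Type*} [Monoid M] [TopologicalSpace M] [ContinuousMul M]
    [PolishSpace M] : PolishSpace Mˣ := by
  have : PolishSpace Mᵐᵒᵖ := (MulOpposite.opHomeomorph (M := M)).symm.isClosedEmbedding.polishSpace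
  exact (Units.isClosedEmbedding_embedProduct (α := M)).polishSpace

theorem unique_taupp (τ : TopologicalSpace (PartialBij ℕ)) (h : GoodTop τ) : τ = taupp ℕ := by
  obtain ⟨hp, hc, hi, -, -⟩ := h
  have m1 : @ContinuousMul _ τ _ := @ContinuousMul.mk _ τ _ hc
  have m2 : @ContinuousMul _ (taupp ℕ) _ := @ContinuousMul.mk _ (taupp ℕ) _ continuous_comp_taupp
  have hle : τ ≤ taupp ℕ := le_taupp τ inferInstance m1 hi
  refine le_antisymm hle ?_
  have hU := polishGroup_unique (G := (PartialBij ℕ)ˣ)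
    (@Units.instTopologicalSpaceUnits _ τ _) (@Units.instTopologicalSpaceUnits _ (taupp ℕ) _)
    (@Units.instIsTopologicalGroupOfContinuousMul _ _ τ m1)
    (@Units.instIsTopologicalGroupOfContinuousMul _ _ (taupp ℕ) m2)
    (@units_polish _ _ τ m1 hp) (@units_polish _ _ (taupp ℕ) m2 polish_taupp)
    (continuous_id_iff_le.1 (@Units.continuous_map _ _ τ _ (taupp ℕ) _ (MonoidHom.id _)
      (continuous_id_iff_le.2 hle)))
  have hd : @Continuous _ _ (taupp ℕ) (@Units.instTopologicalSpaceUnits _ (taupp ℕ) _) dilU := by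
    let := taupp ℕ
    exact Units.continuous_iff.2 ⟨continuous_dil_taupp,
      continuous_dil_taupp.comp continuous_inv_taupp⟩
  rw [← hU] at hd
  have hd' : @Continuous _ _ (taupp ℕ) τ dil :=
    @Continuous.comp _ _ _ (taupp ℕ) (@Units.instTopologicalSpaceUnits _ τ _) τ _ _
      (@Units.continuous_val _ τ _) hd
  have hk : Continuous fun f : PartialBij ℕ => leftCopy.inv * (f * leftCopy) := by fun_prop
  have hf := @Continuous.comp _ _ _ (taupp ℕ) τ τ _ _ hk hd'
  rw [← continuous_id_iff_le]
  convert hf using 1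
  funext f
  exact (compress f).symm

end Aux

end PartialBij

open PartialBij in
/-- `τ_pp` is the unique Polish inverse semigroup topology on `I(ℕ)` for which the
idempotents are compact and every right translation `r_A` is open onto its image. -/
theorem taupp_unique_polish_inverse_semigroup_topology :
    GoodTop (taupp ℕ) ∧
    ∀ τ : TopologicalSpace (PartialBij ℕ), GoodTop τ → τ = taupp ℕ := by
  exact ⟨good_taupp, unique_taupp⟩
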